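/- Let b_{ij} > 0 for i = 1,…,r, j = 1,…,d, and let l(x) = Σ_{i=1}^r max_{j} (b_{ij} x_j) for x ∈ [0,1]^d. Then for any k ∈ {1,…,d} and s ≥ 0: ∫_{[0,1]^d} x_k^s l(x) dx = Σ_{i=1}^r Σ_{j=1}^d [b_{ij}/(1 + s(1−δ_{jk}))] ∫_0^1 (min{(b_{ij}/b_{ik}) x, 1})^s ∏_{m=1}^d min{(b_{ij}/b_{im}) x, 1} dx, where δ_{jk} is the Kronecker delta. -/

import Mathlib

open MeasureTheory

namespace FactorAux

/-- Region on which `j` is the first index attaining the maximum of `a m * x m`. -/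
def reg {n : ℕ} (a : Fin n → ℝ) (j : Fin n) : Set (Fin n → ℝ) :=
  {x | ∀ m, (m < j → a m * x m < a j * x j) ∧ a m * x m ≤ a j * x j}

/-- One-dimensional slice. -/
def slice (p : Prop) (a c : ℝ) : Set ℝ :=
  {u | u ∈ Set.Icc (0 : ℝ) 1 ∧ (p → a * u < c) ∧ a * u ≤ c}

lemma measurable_reg {n : ℕ} (a : Fin n → ℝ) (j : Fin n) : MeasurableSet (reg a j) := by
  have : reg a j = ⋂ m, ({x | m < j → a m * x m < a j * x j} ∩ {x | a m * x m ≤ a j * x j}) := by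
    ext x; simp [reg]
  rw [this]
  refine MeasurableSet.iInter fun m => MeasurableSet.inter ?_ ?_
  · by_cases h : m < j
    · simp only [h, forall_const]
      exact measurableSet_lt (by fun_prop) (by fun_prop)
    · simp [h]
  · exact measurableSet_le (by fun_prop) (by fun_prop)

lemma measurable_slice (p : Prop) (a c : ℝ) : MeasurableSet (slice p a c) := by
  have : slice p a c = Set.Icc 0 1 ∩ ({u | p → a * u < c} ∩ {u | a * u ≤ c}) := by
    ext x; simp [slice]
  rw [this]
  refine measurableSet_Icc.inter (MeasurableSet.inter ?_ ?_)
  · by_cases h : p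
    · simp only [h, forall_const]
      exact measurableSet_lt (by fun_prop) (by fun_prop)
    · simp [h]
  · exact measurableSet_le (by fun_prop) (by fun_prop)

lemma sum_reg {n : ℕ} [NeZero n] (a : Fin n → ℝ) (x : Fin n → ℝ) (w : ℝ) :
    w * (⨆ j, a j * x j) = ∑ j, (reg a j).indicator (fun x => w * (a j * x j)) x := by
  classical
  obtain ⟨j1, hj1⟩ := Finite.exists_max (fun j => a j * x j)
  let S : Finset (Fin n) := Finset.univ.filter (fun j => ∀ m, a m * x m ≤ a j * x j)
  have hS : S.Nonempty := ⟨j1, by simp [S]; exact hj1⟩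
  have hmem := S.min'_mem hS
  have hmin : ∀ m ∈ S, S.min' hS ≤ m := fun m hm => S.min'_le m hm
  generalize S.min' hS = j0 at hmem hmin
  have hmax : ∀ m, a m * x m ≤ a j0 * x j0 := by simpa [S] using hmem
  have h0 : x ∈ reg a j0 := by
    intro m
    refine ⟨fun hlt => lt_of_le_of_ne (hmax m) fun he => ?_, hmax m⟩
    have : m ∈ S := by simp only [S, Finset.mem_filter, Finset.mem_univ, true_and]
                       intro l; rw [he]; exact hmax l
    exact absurd (hmin m this) (not_le.mpr hlt)
  rw [Finset.sum_eq_single j0]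
  · rw [Set.indicator_of_mem h0]
    congr 1
    apply le_antisymm
    · exact ciSup_le hmax
    · exact le_ciSup (f := fun j => a j * x j) (Set.finite_range _).bddAbove j0
  · intro j _ hne
    apply Set.indicator_of_notMem
    intro hj
    rcases lt_or_gt_of_ne hne with h | h
    · exact absurd ((h0 j).1 h) (not_lt.mpr (hj j0).2)
    · exact absurd ((hj j0).1 h) (not_lt.mpr (hmax j))
  · simp

lemma slice_integral (p : Prop) (a c : ℝ) (ha : 0 < a) (hc : 0 ≤ c) (s : ℝ) (hs : 0 ≤ s) :
    ∫ u, (slice p a c).indicator (fun u => u ^ s) u = (min (c / a) 1) ^ (s + 1) / (s + 1) := by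
  have hM : 0 ≤ min (c / a) 1 := le_min (by positivity) zero_le_one
  rw [integral_indicator (measurable_slice p a c)]
  have : slice p a c =ᵐ[volume] Set.Ioc 0 (min (c / a) 1) := by
    have h0 : ∀ᵐ u : ℝ, u ≠ 0 := by simp [ae_iff]
    have h1 : ∀ᵐ u : ℝ, u ≠ c / a := by simp [ae_iff]
    filter_upwards [h0, h1] with u h0 h1
    apply propext
    change u ∈ slice p a c ↔ u ∈ Set.Ioc 0 (min (c / a) 1)
    simp only [slice, Set.mem_setOf_eq, Set.mem_Icc, Set.mem_Ioc, le_min_iff, le_div_iff₀ ha]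
    have h1' : a * u ≠ c := fun h => h1 (by rw [← h]; field_simp)
    constructor
    · rintro ⟨⟨h, h'⟩, -, h3⟩
      exact ⟨lt_of_le_of_ne h (Ne.symm h0), by linarith, h'⟩
    · rintro ⟨h, h2, h3⟩
      exact ⟨⟨h.le, h3⟩, fun _ => lt_of_le_of_ne (by linarith) h1', by linarith⟩
  rw [setIntegral_congr_set this, ← intervalIntegral.integral_of_le hM,
    integral_rpow (Or.inl (by linarith)), Real.zero_rpow (by linarith), sub_zero]

lemma key {n : ℕ} (a : Fin (n + 1) → ℝ) (ha : ∀ j, 0 < a j) (j k : Fin (n + 1))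
    (s : ℝ) (hs : 0 ≤ s)
    (hint : Integrable ((Set.univ.pi (fun _ : Fin (n + 1) => Set.Icc (0 : ℝ) 1) ∩ reg a j).indicator
      (fun x => x k ^ s * (a j * x j)))) :
    ∫ x, (Set.univ.pi (fun _ : Fin (n + 1) => Set.Icc (0 : ℝ) 1) ∩ reg a j).indicator
      (fun x => x k ^ s * (a j * x j)) x =
    (a j / (1 + s * (if j = k then 0 else 1))) *
          ∫ t in Set.Icc (0 : ℝ) 1,
            (min (a j / a k * t) 1) ^ s *
              ∏ m, min (a j / a m * t) 1 := by
  set F := (Set.univ.pi (fun _ : Fin (n + 1) => Set.Icc (0 : ℝ) 1) ∩ reg a j).indicator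
      (fun x => x k ^ s * (a j * x j)) with hF
  have mp := (volume_preserving_piFinSuccAbove (fun _ : Fin (n + 1) => ℝ) j).symm
  rw [← mp.integral_comp' (g := F)]
  have hint2 := (mp.integrable_comp_emb (MeasurableEquiv.measurableEmbedding _)).mpr hint
  rw [Measure.volume_eq_prod] at hint2 ⊢
  simp only [Function.comp_def] at hint2
  rw [integral_prod _ hint2]
  rw [← integral_const_mul, ← integral_indicator measurableSet_Icc]
  congr 1
  ext t
  let e : Fin (n + 1) → ℝ := fun m => if m = k then s else 0
  have he : ∀ m, 0 ≤ e m := by intro m; simp only [e]; split_ifs <;> simp [hs]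
  have hfac : ∀ y : Fin n → ℝ, F ((MeasurableEquiv.piFinSuccAbove (fun _ : Fin (n + 1) => ℝ) j).symm (t, y)) =
      (Set.Icc (0:ℝ) 1).indicator (fun t => t ^ (e j) * (a j * t)) t *
      ∏ m : Fin n, (slice (j.succAbove m < j) (a (j.succAbove m)) (a j * t)).indicator
        (fun u => u ^ (e (j.succAbove m))) (y m) := by
    intro y
    have hx : (MeasurableEquiv.piFinSuccAbove (fun _ : Fin (n + 1) => ℝ) j).symm (t, y) =
      j.insertNth t y := rfl
    rw [hx]
    by_cases hm : t ∈ Set.Icc (0:ℝ) 1 ∧ ∀ m, y m ∈ slice (j.succAbove m < j) (a (j.succAbove m)) (a j * t)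
    · have h1 : (j.insertNth t y : Fin (n + 1) → ℝ) ∈ (Set.univ.pi (fun _ : Fin (n + 1) => Set.Icc (0 : ℝ) 1) ∩ reg a j) := by
        refine ⟨?_, ?_⟩
        · rw [Set.mem_univ_pi, Fin.forall_iff_succAbove j]
          simp only [Fin.insertNth_apply_same, Fin.insertNth_apply_succAbove]
          exact ⟨hm.1, fun m => (hm.2 m).1⟩
        · simp only [reg, Set.mem_setOf_eq]
          rw [Fin.forall_iff_succAbove j]
          simp only [Fin.insertNth_apply_same, Fin.insertNth_apply_succAbove]
          exact ⟨⟨fun h => absurd h (lt_irrefl _), le_rfl⟩, fun m => (hm.2 m).2⟩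
      rw [hF, Set.indicator_of_mem h1, Set.indicator_of_mem hm.1,
        Finset.prod_congr rfl fun m _ => Set.indicator_of_mem (hm.2 m) _]
      have : (j.insertNth t y : Fin (n + 1) → ℝ) k ^ s = 
          ∏ m, (j.insertNth t y : Fin (n + 1) → ℝ) m ^ (e m) := by
        rw [Finset.prod_eq_single k]
        · simp [e]
        · intro m _ hne; simp [e, hne]
        · simp
      rw [this, Fin.prod_univ_succAbove _ j]
      simp only [Fin.insertNth_apply_same, Fin.insertNth_apply_succAbove]
      ring
    · rw [hF, Set.indicator_of_notMem]
      · symm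
        by_cases ht : t ∈ Set.Icc (0:ℝ) 1
        · have : ∃ m, y m ∉ slice (j.succAbove m < j) (a (j.succAbove m)) (a j * t) := by
            by_contra hcon
            push Not at hcon
            exact hm ⟨ht, hcon⟩
          obtain ⟨m, hm'⟩ := this
          rw [Finset.prod_eq_zero (Finset.mem_univ m), mul_zero]
          exact Set.indicator_of_notMem hm' _
        · rw [Set.indicator_of_notMem ht, zero_mul]
      · rintro ⟨h1, h2⟩
        apply hm
        rw [Set.mem_univ_pi] at h1
        constructor
        · simpa using h1 j
        · intro m
          have h3 := h1 (j.succAbove m)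
          have h4 := h2 (j.succAbove m)
          simp only [Fin.insertNth_apply_same, Fin.insertNth_apply_succAbove] at h3 h4
          exact ⟨h3, h4⟩
  simp only [hfac]
  rw [integral_const_mul]
  by_cases ht : t ∈ Set.Icc (0:ℝ) 1
  swap
  · rw [Set.indicator_of_notMem ht, Set.indicator_of_notMem ht, zero_mul]
  rw [Set.indicator_of_mem ht, Set.indicator_of_mem ht]
  rw [integral_fintype_prod_volume_eq_prod (fun m : Fin n => 
    (slice (j.succAbove m < j) (a (j.succAbove m)) (a j * t)).indicator
        (fun u => u ^ (e (j.succAbove m))))]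
  have hc : 0 ≤ a j * t := mul_nonneg (ha j).le ht.1
  rw [Finset.prod_congr rfl fun m _ => slice_integral _ _ _ (ha _) hc _ (he _)]
  -- uniform expression
  have hcc : ∀ m, a j / a m * t = a j * t / a m := fun m => by ring
  simp only [hcc]
  have hM : ∀ m, 0 ≤ min (a j * t / a m) 1 := fun m =>
    le_min (div_nonneg hc (ha m).le) zero_le_one
  have hj : min (a j * t / a j) 1 = t := by
    rw [mul_div_cancel_left₀ _ (ha j).ne']; exact min_eq_left ht.2
  have hk : min (a j * t / a k) 1 ^ s = ∏ m, min (a j * t / a m) 1 ^ (e m) := by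
    rw [Finset.prod_eq_single k]
    · simp [e]
    · intro m _ hne; simp [e, hne]
    · simp
  have hden : 1 + s * (if j = k then 0 else 1) = ∏ m : Fin n, (e (j.succAbove m) + 1) := by
    have h2 : ∏ m, (e m + 1) = s + 1 := by
      rw [Finset.prod_eq_single k]
      · simp [e]
      · intro m _ hne; simp [e, hne]
      · simp
    rw [Fin.prod_univ_succAbove _ j] at h2
    by_cases hjk : j = k
    · have : e j = s := by simp [e, hjk]
      rw [this] at h2
      have h3 : s + 1 ≠ 0 := by linarith
      simp only [hjk, if_true, mul_zero, add_zero]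
      rw [← hjk]
      exact (mul_left_cancel₀ h3 (by rw [h2, mul_one])).symm
    · have : e j = 0 := by simp [e, hjk]
      rw [this] at h2
      simp only [hjk, if_false]
      linarith
  rw [hk, hden, Fin.prod_univ_succAbove _ j, Fin.prod_univ_succAbove (fun m => min (a j * t / a m) 1) j, hj,
    Finset.prod_div_distrib]
  have hpow : ∀ m : Fin n, min (a j * t / a (j.succAbove m)) 1 ^ (e (j.succAbove m) + 1) =
      min (a j * t / a (j.succAbove m)) 1 ^ (e (j.succAbove m)) * min (a j * t / a (j.succAbove m)) 1 := by
    intro m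
    rw [Real.rpow_add_one' (hM _) (by have := he (j.succAbove m); linarith)]
  simp only [hpow, Finset.prod_mul_distrib]
  ring

end FactorAux

open FactorAux in
theorem stmt_16 (d r : ℕ) (hd : 1 ≤ d) (hr : 1 ≤ r)
    (b : Fin r → Fin d → ℝ) (hb : ∀ i j, 0 < b i j)
    (k : Fin d) (s : ℝ) (hs : 0 ≤ s) :
    (∫ x in Set.univ.pi (fun _ : Fin d => Set.Icc (0 : ℝ) 1),
        x k ^ s * ∑ i, (⨆ j, b i j * x j)) =
      ∑ i, ∑ j,
        (b i j / (1 + s * (if j = k then 0 else 1))) *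
          ∫ t in Set.Icc (0 : ℝ) 1,
            (min (b i j / b i k * t) 1) ^ s *
              ∏ m, min (b i j / b i m * t) 1 := by
  obtain ⟨n, rfl⟩ : ∃ n, d = n + 1 := ⟨d - 1, by omega⟩
  have hmc : MeasurableSet (Set.univ.pi (fun _ : Fin (n + 1) => Set.Icc (0 : ℝ) 1)) :=
    MeasurableSet.univ_pi fun _ => measurableSet_Icc
  have hI : ∀ i j, Integrable ((Set.univ.pi (fun _ : Fin (n + 1) => Set.Icc (0 : ℝ) 1) ∩ reg (b i) j).indicator
      (fun x => x k ^ s * (b i j * x j))) := by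
    intro i j
    rw [integrable_indicator_iff (hmc.inter (measurable_reg _ _))]
    refine IntegrableOn.mono_set ?_ Set.inter_subset_left
    apply ContinuousOn.integrableOn_compact (isCompact_univ_pi fun _ => isCompact_Icc)
    apply Continuous.continuousOn
    exact ((Real.continuous_rpow_const hs).comp (continuous_apply k)).mul (by fun_prop)
  rw [← integral_indicator hmc]
  have hpt : ∀ x : Fin (n + 1) → ℝ, (Set.univ.pi (fun _ : Fin (n + 1) => Set.Icc (0 : ℝ) 1)).indicator
      (fun x => x k ^ s * ∑ i, (⨆ j, b i j * x j)) x = ∑ i, ∑ j,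
      (Set.univ.pi (fun _ : Fin (n + 1) => Set.Icc (0 : ℝ) 1) ∩ reg (b i) j).indicator
      (fun x => x k ^ s * (b i j * x j)) x := by
    intro x
    simp only [← Set.indicator_indicator]
    by_cases hx : x ∈ Set.univ.pi (fun _ : Fin (n + 1) => Set.Icc (0 : ℝ) 1)
    · simp only [Set.indicator_of_mem hx, Finset.mul_sum]
      refine Finset.sum_congr rfl fun i _ => ?_
      rw [sum_reg]
      refine Finset.sum_congr rfl fun j _ => ?_
      simp only [Set.indicator]
    · simp only [Set.indicator_of_notMem hx, Finset.sum_const_zero]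
  simp only [hpt]
  rw [integral_finset_sum _ fun i _ => integrable_finset_sum _ fun j _ => hI i j]
  refine Finset.sum_congr rfl fun i _ => ?_
  rw [integral_finset_sum _ fun j _ => hI i j]
  exact Finset.sum_congr rfl fun j _ => key (b i) (hb i) j k s hs (hI i j)
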